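/- Let d, r ≥ 1, let ψ be a bipartite pure state on ℂ^d ⊗ ℂ^d whose associated matrix M has rank at most r, and let (G_μ)_{μ ∈ Fin (d^2)} and (H_μ)_{μ ∈ Fin (d^2)} be Hermitian orthonormal operator bases of the d × d complex matrices. Then Σ_μ | Re⟨ψ, (G_μ ⊗ H_μ) ψ⟩ − Re⟨ψ, (G_μ ⊗ I) ψ⟩ · Re⟨ψ, (I ⊗ H_μ) ψ⟩ | ≤ r − Re tr((M · Mᴴ)²). -/

import Mathlib

open Matrix Kronecker BigOperators

/-- The `d × d` matrix associated to a bipartite vector on `ℂ^d ⊗ ℂ^d`. -/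
noncomputable def assocMatrix {d : ℕ} (ψ : Fin d × Fin d → ℂ) : Matrix (Fin d) (Fin d) ℂ :=
  Matrix.of fun i j => ψ (i, j)

/-- A Hermitian orthonormal operator basis of the `d × d` complex matrices. -/
def IsHermitianONB (d : ℕ) (G : Fin (d ^ 2) → Matrix (Fin d) (Fin d) ℂ) : Prop :=
  (∀ μ, (G μ).IsHermitian) ∧
  (∀ μ ν, ((G μ)ᴴ * G ν).trace = if μ = ν then 1 else 0)

lemma onb_complete {d : ℕ} {G : Fin (d ^ 2) → Matrix (Fin d) (Fin d) ℂ}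
    (hG : IsHermitianONB d G) (i j k l : Fin d) :
    ∑ μ, G μ i j * G μ k l = (if i = l then 1 else 0) * (if j = k then 1 else 0) := by
  let T : Matrix (Fin d × Fin d) (Fin (d^2)) ℂ := Matrix.of fun x μ => G μ x.1 x.2
  have h1 : Tᴴ * T = 1 := by
    ext μ ν
    rw [Matrix.one_apply, ← hG.2 μ ν]
    simp only [Matrix.mul_apply, Matrix.trace, Matrix.diag, Fintype.sum_prod_type, T,
      Matrix.conjTranspose_apply, Matrix.of_apply]
    rw [Finset.sum_comm]
  have h2 : T * Tᴴ = 1 := by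
    rw [Matrix.mul_eq_one_comm_of_card_eq _ _ _ (by simp [pow_two])]
    exact h1
  have h3 := congrFun (congrFun h2 (i, j)) (l, k)
  have h4 : ∀ μ, star (G μ l k) = G μ k l := fun μ => (hG.1 μ).apply k l
  simp only [Matrix.mul_apply, T, Matrix.conjTranspose_apply, Matrix.of_apply, h4] at h3
  rw [h3, Matrix.one_apply]
  by_cases a : i = l <;> by_cases b : j = k <;> simp [a, b]

noncomputable def QQ {d : ℕ} (s : Fin d → ℝ) (Y : Matrix (Fin d) (Fin d) ℂ) : ℝ :=
  ∑ a, ∑ b, s a * s b * Complex.normSq (Y a b) - (∑ a, s a ^ 2 * (Y a a).re) ^ 2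

lemma QQ_nonneg {d : ℕ} (s : Fin d → ℝ) (hs : ∀ a, 0 ≤ s a) (h1 : ∑ a, s a ^ 2 = 1)
    (Y : Matrix (Fin d) (Fin d) ℂ) : 0 ≤ QQ s Y := by
  unfold QQ
  rw [sub_nonneg]
  calc (∑ a, s a ^ 2 * (Y a a).re) ^ 2 = (∑ a, s a * (s a * (Y a a).re)) ^ 2 := by
        congr 1; apply Finset.sum_congr rfl; intros; ring
    _ ≤ (∑ a, s a ^ 2) * ∑ a, (s a * (Y a a).re) ^ 2 := Finset.sum_mul_sq_le_sq_mul_sq _ _ _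
    _ = ∑ a, (s a * (Y a a).re) ^ 2 := by rw [h1, one_mul]
    _ ≤ _ := by
      apply Finset.sum_le_sum
      intro a _
      calc (s a * (Y a a).re) ^ 2 ≤ s a * s a * Complex.normSq (Y a a) := by
            rw [Complex.normSq_apply]
            nlinarith [mul_nonneg (mul_nonneg (hs a) (hs a)) (mul_self_nonneg (Y a a).im)]
        _ ≤ _ := Finset.single_le_sum (f := fun b => s a * s b * Complex.normSq (Y a b))
            (fun b _ => mul_nonneg (mul_nonneg (hs a) (hs b)) (Complex.normSq_nonneg _))
            (Finset.mem_univ a)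

noncomputable def BB {d : ℕ} (s : Fin d → ℝ) (Y Z : Matrix (Fin d) (Fin d) ℂ) : ℝ :=
  ∑ a, ∑ b, s a * s b * (Y a b * Z b a).re
    - (∑ a, s a ^ 2 * (Y a a).re) * (∑ a, s a ^ 2 * (Z a a).re)

lemma QQ_add {d : ℕ} (s : Fin d → ℝ) (Y Z : Matrix (Fin d) (Fin d) ℂ) (hZ : Z.IsHermitian)
    (t : ℝ) (ht : t ^ 2 = 1) :
    QQ s (Y + (t : ℂ) • Z) = QQ s Y + QQ s Z + t * (2 * BB s Y Z) := by
  unfold QQ BB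
  have e1 : ∑ a, s a ^ 2 * ((Y + (t : ℂ) • Z) a a).re
      = ∑ a, s a ^ 2 * (Y a a).re + t * ∑ a, s a ^ 2 * (Z a a).re := by
    rw [Finset.mul_sum, ← Finset.sum_add_distrib]
    apply Finset.sum_congr rfl; intro a _
    simp; ring
  have e2 : ∑ a, ∑ b, s a * s b * Complex.normSq ((Y + (t : ℂ) • Z) a b)
      = ∑ a, ∑ b, s a * s b * Complex.normSq (Y a b)
      + ∑ a, ∑ b, s a * s b * Complex.normSq (Z a b)
      + (2 * t) * ∑ a, ∑ b, s a * s b * (Y a b * Z b a).re := by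
    simp only [Finset.mul_sum, ← Finset.sum_add_distrib]
    apply Finset.sum_congr rfl; intro a _
    apply Finset.sum_congr rfl; intro b _
    rw [← hZ.apply b a]
    simp [Complex.normSq_apply]
    linear_combination (s a * s b * ((Z a b).re ^ 2 + (Z a b).im ^ 2)) * ht
  rw [e1, e2]
  linear_combination (-(∑ a, s a ^ 2 * (Z a a).re) ^ 2) * ht

lemma BB_le {d : ℕ} (s : Fin d → ℝ) (hs : ∀ a, 0 ≤ s a) (h1 : ∑ a, s a ^ 2 = 1)
    (Y Z : Matrix (Fin d) (Fin d) ℂ) (hZ : Z.IsHermitian) :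
    |BB s Y Z| ≤ (QQ s Y + QQ s Z) / 2 := by
  have a1 := QQ_add s Y Z hZ 1 (by norm_num)
  have a2 := QQ_add s Y Z hZ (-1) (by norm_num)
  have b1 := QQ_nonneg s hs h1 (Y + ((1 : ℝ) : ℂ) • Z)
  have b2 := QQ_nonneg s hs h1 (Y + ((-1 : ℝ) : ℂ) • Z)
  rw [abs_le]; constructor <;> linarith

lemma conj_complete {d : ℕ} {ι : Type*} [Fintype ι] (G : ι → Matrix (Fin d) (Fin d) ℂ)
    (hG : ∀ i j k l, ∑ μ, G μ i j * G μ k l = (if i = l then 1 else 0) * (if j = k then 1 else 0))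
    (X : Matrix (Fin d) (Fin d) ℂ) (a b c e : Fin d) :
    ∑ μ, (X * G μ * Xᴴ) a b * (X * G μ * Xᴴ) c e = (X * Xᴴ) a e * (X * Xᴴ) c b := by
  have h0 : ∀ μ a b, (X * G μ * Xᴴ) a b = ∑ j, ∑ i, X a i * G μ i j * Xᴴ j b := by
    intro μ a b
    simp only [Matrix.mul_apply, Finset.sum_mul]
  have h : ∀ μ, (X * G μ * Xᴴ) a b * (X * G μ * Xᴴ) c e
      = ∑ j, ∑ l, ∑ i, ∑ k, X a i * Xᴴ j b * X c k * Xᴴ l e * (G μ i j * G μ k l) := by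
    intro μ
    rw [h0, h0, Finset.sum_mul_sum]
    apply Finset.sum_congr rfl; intro j _
    apply Finset.sum_congr rfl; intro l _
    rw [Finset.sum_mul_sum]
    apply Finset.sum_congr rfl; intro i _
    apply Finset.sum_congr rfl; intro k _
    ring
  have h' : ∑ μ, (X * G μ * Xᴴ) a b * (X * G μ * Xᴴ) c e
      = ∑ j, ∑ l, ∑ i, ∑ k, X a i * Xᴴ j b * X c k * Xᴴ l e * ∑ μ, (G μ i j * G μ k l) := by
    simp only [h]
    rw [Finset.sum_comm]
    apply Finset.sum_congr rfl; intro j _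
    rw [Finset.sum_comm]
    apply Finset.sum_congr rfl; intro l _
    rw [Finset.sum_comm]
    apply Finset.sum_congr rfl; intro i _
    rw [Finset.sum_comm]
    apply Finset.sum_congr rfl; intro k _
    rw [Finset.mul_sum]
  rw [h', Finset.sum_comm, Matrix.mul_apply, Matrix.mul_apply, Finset.sum_mul_sum]
  simp only [hG]
  apply Finset.sum_congr rfl; intro l _
  apply Finset.sum_congr rfl; intro j _
  simp
  ring

lemma sum_QQ {d : ℕ} {ι : Type*} [Fintype ι] (J : ι → Matrix (Fin d) (Fin d) ℂ)
    (hJ : ∀ μ, (J μ).IsHermitian) (s e : Fin d → ℝ) (he : ∀ a, s a * e a = s a)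
    (h : ∀ a b c f, ∑ μ, J μ a b * J μ c f
      = (if a = f then (e a : ℂ) else 0) * (if c = b then (e c : ℂ) else 0)) :
    ∑ μ, QQ s (J μ) = (∑ a, s a) ^ 2 - ∑ a, (s a ^ 2) ^ 2 := by
  unfold QQ
  rw [Finset.sum_sub_distrib]
  congr 1
  · rw [Finset.sum_comm, pow_two, Finset.sum_mul_sum]
    apply Finset.sum_congr rfl; intro a _
    rw [Finset.sum_comm]
    apply Finset.sum_congr rfl; intro b _
    rw [← Finset.mul_sum]
    have h0 := congrArg Complex.re (h a b b a)
    rw [Complex.re_sum] at h0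
    have h1 : ∑ μ, Complex.normSq (J μ a b) = e a * e b := by
      simp only [if_true, ← Complex.ofReal_mul, Complex.ofReal_re] at h0
      rw [← h0]
      apply Finset.sum_congr rfl; intro μ _
      rw [← (hJ μ).apply b a]
      simp [Complex.normSq_apply]
    rw [h1]
    linear_combination (s b * e b) * he a + s a * he b
  · have h2 : ∀ a c, ∑ μ, (J μ a a).re * (J μ c c).re = if a = c then e a * e a else 0 := by
      intro a c
      have h0 := congrArg Complex.re (h a a c c)
      rw [Complex.re_sum] at h0
      have im : ∀ μ, (J μ a a).im = 0 := fun μ => by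
        have := congrArg Complex.im ((hJ μ).apply a a)
        simp at this; linarith
      have : ∀ μ, (J μ a a * J μ c c).re = (J μ a a).re * (J μ c c).re := fun μ => by
        simp [im μ]
      simp only [this] at h0
      rw [h0]
      by_cases hh : a = c
      · subst hh; simp
      · simp [hh]
    have : ∀ μ, (∑ a, s a ^ 2 * (J μ a a).re) ^ 2
        = ∑ a, ∑ c, s a ^ 2 * s c ^ 2 * ((J μ a a).re * (J μ c c).re) := fun μ => by
      rw [pow_two, Finset.sum_mul_sum]
      apply Finset.sum_congr rfl; intro a _
      apply Finset.sum_congr rfl; intro b _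
      ring
    simp only [this]
    rw [Finset.sum_comm]
    apply Finset.sum_congr rfl; intro a _
    rw [Finset.sum_comm]
    simp only [← Finset.mul_sum, h2]
    simp
    linear_combination (s a ^ 2) * (s a * e a + s a) * he a


open scoped ComplexOrder in
lemma svd_lemma {d : ℕ} (M : Matrix (Fin d) (Fin d) ℂ) :
    ∃ (U V : Matrix (Fin d) (Fin d) ℂ) (s e : Fin d → ℝ), Uᴴ * U = 1 ∧ (∀ a, 0 ≤ s a) ∧
      (∀ a, s a * e a = s a) ∧ V * Vᴴ = diagonal (fun a => (e a : ℂ)) ∧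
      M = U * diagonal (fun a => (s a : ℂ)) * V ∧
      (Finset.univ.filter (fun a => s a ≠ 0)).card = M.rank := by
  have hP : (M * Mᴴ).PosSemidef := posSemidef_self_mul_conjTranspose M
  have hA := hP.isHermitian
  let U : Matrix (Fin d) (Fin d) ℂ := hA.eigenvectorUnitary
  have hU : Uᴴ * U = 1 := Unitary.coe_star_mul_self hA.eigenvectorUnitary
  have hU' : U * Uᴴ = 1 := Unitary.coe_mul_star_self hA.eigenvectorUnitary
  let p := hA.eigenvalues
  have hp : ∀ a, 0 ≤ p a := hP.eigenvalues_nonneg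
  have hd : Uᴴ * (M * Mᴴ) * U = diagonal (fun a => (p a : ℂ)) := by
    have := hA.conjStarAlgAut_star_eigenvectorUnitary
    rw [Unitary.conjStarAlgAut_star_apply] at this
    exact this
  let A := Uᴴ * M
  have hAA : A * Aᴴ = diagonal (fun a => (p a : ℂ)) := by
    rw [← hd]
    simp [A, Matrix.conjTranspose_mul, Matrix.mul_assoc]
  let s : Fin d → ℝ := fun a => Real.sqrt (p a)
  have hsp : ∀ a, s a * s a = p a := fun a => Real.mul_self_sqrt (hp a)
  have hs0 : ∀ a, s a = 0 ↔ p a = 0 := fun a => Real.sqrt_eq_zero (hp a)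
  let V : Matrix (Fin d) (Fin d) ℂ := diagonal (fun a => ((s a)⁻¹ : ℂ)) * A
  refine ⟨U, V, s, fun a => if s a = 0 then 0 else 1, hU, fun a => Real.sqrt_nonneg _, ?_, ?_, ?_, ?_⟩
  · intro a
    by_cases h : s a = 0 <;> simp [h]
  · have : V * Vᴴ = diagonal (fun a => ((s a)⁻¹ : ℂ)) * (A * Aᴴ) *
        (diagonal (fun a => ((s a)⁻¹ : ℂ)))ᴴ := by
      simp only [V, Matrix.conjTranspose_mul, Matrix.mul_assoc]
    rw [this, hAA, diagonal_conjTranspose, diagonal_mul_diagonal, diagonal_mul_diagonal]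
    congr 1
    funext a
    rw [← hsp a]
    by_cases h : s a = 0
    · simp [h]
    · have : (s a : ℂ) ≠ 0 := by exact_mod_cast h
      simp [h]
  · have hAS : diagonal (fun a => (s a : ℂ)) * V = A := by
      ext a i
      simp only [V, diagonal_mul]
      by_cases h : s a = 0
      · have h1 := congrFun (congrFun hAA a) a
        rw [diagonal_apply_eq, (hs0 a).1 h, Matrix.mul_apply] at h1
        have h2 : ∑ j, Complex.normSq (A a j) = 0 := by
          have : ((∑ j, Complex.normSq (A a j) : ℝ) : ℂ) = 0 := by
            rw [← Complex.ofReal_zero, ← h1]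
            push_cast
            apply Finset.sum_congr rfl; intro j _
            rw [← Complex.mul_conj]; rfl
          exact_mod_cast this
        have h3 := (Finset.sum_eq_zero_iff_of_nonneg
          (fun j _ => Complex.normSq_nonneg (A a j))).1 h2 i (Finset.mem_univ i)
        rw [Complex.normSq_eq_zero.1 h3]; simp
      · have : (s a : ℂ) ≠ 0 := by exact_mod_cast h
        field_simp
    rw [Matrix.mul_assoc, hAS, ← Matrix.mul_assoc, hU', Matrix.one_mul]
  · rw [← rank_self_mul_conjTranspose M, hA.rank_eq_card_non_zero_eigs, Fintype.card_subtype]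
    congr 1
    ext a
    simp only [Finset.mem_filter, Finset.mem_univ, true_and]
    exact not_congr (hs0 a)

lemma expect_eq {d : ℕ} (ψ : Fin d × Fin d → ℂ) (G H : Matrix (Fin d) (Fin d) ℂ) :
    star ψ ⬝ᵥ ((G ⊗ₖ H) *ᵥ ψ) =
      ((assocMatrix ψ)ᴴ * (G * assocMatrix ψ * Hᵀ)).trace := by
  simp only [dotProduct, mulVec, Fintype.sum_prod_type, Matrix.trace, Matrix.diag, Matrix.mul_apply,
    conjTranspose_apply, assocMatrix, of_apply, kroneckerMap_apply, transpose_apply, Pi.star_apply]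
  rw [Finset.sum_comm]
  apply Finset.sum_congr rfl; intro j _
  apply Finset.sum_congr rfl; intro i _
  congr 1
  rw [Finset.sum_comm]
  apply Finset.sum_congr rfl; intro k _
  rw [Finset.sum_mul]
  apply Finset.sum_congr rfl; intro l _
  ring

lemma trace_svd {d : ℕ} (U V : Matrix (Fin d) (Fin d) ℂ) (s : Fin d → ℝ)
    (G K : Matrix (Fin d) (Fin d) ℂ) :
    ((U * diagonal (fun a => (s a : ℂ)) * V)ᴴ *
      (G * (U * diagonal (fun a => (s a : ℂ)) * V) * K)).trace =
    ∑ a, ∑ b, ((s a * s b : ℝ) : ℂ) * ((Uᴴ * G * Uᴴᴴ) a b * (V * K * Vᴴ) b a) := by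
  have hS : (diagonal (fun a => (s a : ℂ)))ᴴ = diagonal (fun a => (s a : ℂ)) := by
    rw [diagonal_conjTranspose]; congr 1; funext a; simp
  have : ((U * diagonal (fun a => (s a : ℂ)) * V)ᴴ *
      (G * (U * diagonal (fun a => (s a : ℂ)) * V) * K)).trace
      = ((diagonal (fun a => (s a : ℂ)) * (Uᴴ * G * Uᴴᴴ)) *
        (diagonal (fun a => (s a : ℂ)) * (V * K * Vᴴ))).trace := by
    rw [Matrix.conjTranspose_mul, Matrix.conjTranspose_mul, hS, Matrix.mul_assoc,
      Matrix.trace_mul_comm]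
    simp only [Matrix.mul_assoc, conjTranspose_conjTranspose]
  rw [this]
  simp only [Matrix.trace, Matrix.diag]
  apply Finset.sum_congr rfl; intro a _
  rw [Matrix.mul_apply]
  apply Finset.sum_congr rfl; intro b _
  rw [diagonal_mul, diagonal_mul]
  push_cast; ring

theorem stmt_1 (d r : ℕ) (hd : 1 ≤ d) (hr : 1 ≤ r)
    (ψ : Fin d × Fin d → ℂ)
    (hψ : ∑ ij, Complex.normSq (ψ ij) = 1)
    (M : Matrix (Fin d) (Fin d) ℂ) (hM : M = assocMatrix ψ)
    (hrank : M.rank ≤ r)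
    (G H : Fin (d ^ 2) → Matrix (Fin d) (Fin d) ℂ)
    (hG : IsHermitianONB d G) (hH : IsHermitianONB d H) :
    ∑ μ, |(star ψ ⬝ᵥ ((G μ ⊗ₖ H μ) *ᵥ ψ)).re -
          (star ψ ⬝ᵥ ((G μ ⊗ₖ (1 : Matrix (Fin d) (Fin d) ℂ)) *ᵥ ψ)).re *
          (star ψ ⬝ᵥ (((1 : Matrix (Fin d) (Fin d) ℂ) ⊗ₖ H μ) *ᵥ ψ)).re| ≤
      (r : ℝ) - ((M * Mᴴ) * (M * Mᴴ)).trace.re := by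
  obtain ⟨U, V, s, e, hU, hs, hse, hV, hMs, hcard⟩ := svd_lemma M
  have hS : (diagonal (fun a => (s a : ℂ)))ᴴ = diagonal (fun a => (s a : ℂ)) := by
    rw [diagonal_conjTranspose]; congr 1; funext a; simp
  have hMM : M * Mᴴ = U * diagonal (fun a => ((s a ^ 2 : ℝ) : ℂ)) * Uᴴ := by
    have h1 : M * Mᴴ = U * (diagonal (fun a => (s a : ℂ)) * (V * Vᴴ) *
        diagonal (fun a => (s a : ℂ))) * Uᴴ := by
      rw [hMs, Matrix.conjTranspose_mul, Matrix.conjTranspose_mul, hS]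
      simp only [Matrix.mul_assoc]
    rw [h1, hV, diagonal_mul_diagonal, diagonal_mul_diagonal]
    congr 3
    funext a
    rw [← Complex.ofReal_mul, hse a, ← Complex.ofReal_mul, pow_two]
  have hpur : ((M * Mᴴ) * (M * Mᴴ)).trace.re = ∑ a, (s a ^ 2) ^ 2 := by
    have : (M * Mᴴ) * (M * Mᴴ) = U * (diagonal (fun a => ((s a ^ 2 : ℝ) : ℂ)) * (Uᴴ * U) *
      diagonal (fun a => ((s a ^ 2 : ℝ) : ℂ))) * Uᴴ := by
      rw [hMM]; simp only [Matrix.mul_assoc]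
    rw [this, Matrix.trace_mul_comm, ← Matrix.mul_assoc, hU, Matrix.one_mul, Matrix.mul_one,
      diagonal_mul_diagonal, trace_diagonal, Complex.re_sum]
    apply Finset.sum_congr rfl; intro a _
    rw [← Complex.ofReal_mul, Complex.ofReal_re]; ring
  have hs1 : ∑ a, s a ^ 2 = 1 := by
    have h1 : (M * Mᴴ).trace = ((∑ a, s a ^ 2 : ℝ) : ℂ) := by
      rw [hMM, Matrix.trace_mul_comm, ← Matrix.mul_assoc, hU, Matrix.one_mul, trace_diagonal,
        Complex.ofReal_sum]
    have h2 : (M * Mᴴ).trace = ((∑ ij, Complex.normSq (ψ ij) : ℝ) : ℂ) := by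
      rw [hM, Complex.ofReal_sum, Fintype.sum_prod_type]
      simp only [Matrix.trace, Matrix.diag, Matrix.mul_apply]
      apply Finset.sum_congr rfl; intro i _
      apply Finset.sum_congr rfl; intro j _
      rw [← Complex.mul_conj]; rfl
    rw [hψ, h1] at h2
    exact_mod_cast h2
  let J : Fin (d ^ 2) → Matrix (Fin d) (Fin d) ℂ := fun μ => Uᴴ * G μ * Uᴴᴴ
  let K : Fin (d ^ 2) → Matrix (Fin d) (Fin d) ℂ := fun μ => V * (H μ)ᵀ * Vᴴ
  have hJh : ∀ μ, (J μ).IsHermitian := fun μ => isHermitian_mul_mul_conjTranspose _ (hG.1 μ)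
  have hKh : ∀ μ, (K μ).IsHermitian := fun μ =>
    isHermitian_mul_mul_conjTranspose _ (hH.1 μ).transpose
  have hJQ : ∑ μ, QQ s (J μ) = (∑ a, s a) ^ 2 - ∑ a, (s a ^ 2) ^ 2 := by
    apply sum_QQ J hJh s (fun _ => 1) (fun a => mul_one _)
    intro a b c f
    rw [conj_complete G (onb_complete hG) Uᴴ a b c f, conjTranspose_conjTranspose, hU,
      Matrix.one_apply, Matrix.one_apply]
    simp
  have hKQ : ∑ μ, QQ s (K μ) = (∑ a, s a) ^ 2 - ∑ a, (s a ^ 2) ^ 2 := by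
    apply sum_QQ K hKh s e hse
    intro a b c f
    rw [conj_complete (fun μ => (H μ)ᵀ) _ V a b c f, hV, diagonal_apply, diagonal_apply]
    intro i j k l
    simp only [transpose_apply]
    rw [onb_complete hH, mul_comm]
  have hB : ∀ μ, (star ψ ⬝ᵥ ((G μ ⊗ₖ H μ) *ᵥ ψ)).re -
          (star ψ ⬝ᵥ ((G μ ⊗ₖ (1 : Matrix (Fin d) (Fin d) ℂ)) *ᵥ ψ)).re *
          (star ψ ⬝ᵥ (((1 : Matrix (Fin d) (Fin d) ℂ) ⊗ₖ H μ) *ᵥ ψ)).re = BB s (J μ) (K μ) := by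
    intro μ
    rw [expect_eq, expect_eq, expect_eq, ← hM, hMs, trace_svd, trace_svd, trace_svd]
    unfold BB
    congr 1
    · simp only [Complex.re_sum, Complex.re_ofReal_mul]; rfl
    · congr 1
      · rw [transpose_one, Matrix.mul_one, hV]
        simp only [Complex.re_sum, Complex.re_ofReal_mul]
        apply Finset.sum_congr rfl; intro a _
        rw [Finset.sum_eq_single a]
        · rw [diagonal_apply_eq, mul_comm (_ : ℂ) (e a : ℂ), Complex.re_ofReal_mul]
          change _ = s a ^ 2 * ((Uᴴ * G μ * Uᴴᴴ) a a).re
          linear_combination (s a * ((Uᴴ * G μ * Uᴴᴴ) a a).re) * hse a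
        · intro b _ hb
          rw [diagonal_apply_ne _ hb]; simp
        · simp
      · rw [Matrix.mul_one, conjTranspose_conjTranspose, hU]
        simp only [Complex.re_sum, Complex.re_ofReal_mul]
        apply Finset.sum_congr rfl; intro a _
        rw [Finset.sum_eq_single a]
        · rw [Matrix.one_apply_eq, one_mul, pow_two]
        · intro b _ hb
          rw [Matrix.one_apply_ne hb.symm]; simp
        · simp
  have hsum : (∑ a, s a) ^ 2 ≤ r := by
    have h1 : ∑ a, s a = ∑ a ∈ Finset.univ.filter (fun a => s a ≠ 0), s a :=
      (Finset.sum_filter_ne_zero _).symm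
    rw [h1]
    refine sq_sum_le_card_mul_sum_sq.trans ?_
    rw [hcard]
    have h2 : ∑ a ∈ Finset.univ.filter (fun a => s a ≠ 0), s a ^ 2 ≤ 1 := by
      rw [← hs1]
      exact Finset.sum_le_sum_of_subset_of_nonneg (Finset.filter_subset _ _)
        (fun a _ _ => sq_nonneg _)
    calc (M.rank : ℝ) * _ ≤ M.rank * 1 := by gcongr
      _ ≤ r := by rw [mul_one]; exact_mod_cast hrank
  simp only [hB]
  calc ∑ μ, |BB s (J μ) (K μ)| ≤ ∑ μ, (QQ s (J μ) + QQ s (K μ)) / 2 :=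
        Finset.sum_le_sum fun μ _ => BB_le s hs hs1 _ _ (hKh μ)
    _ = (∑ a, s a) ^ 2 - ∑ a, (s a ^ 2) ^ 2 := by
        rw [← Finset.sum_div, Finset.sum_add_distrib, hJQ, hKQ]; ring
    _ ≤ _ := by rw [hpur]; linarith
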